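/- Let e_1, e_2 ∈ 𝕊^n be distinct, let x_1, x_2 > 0, and set P = B̄_{e_1}(x_1) ∩ B̄_{e_2}(x_2). For t > 0 let P_t = 𝒫_t(P, F̊(P,e_1)) = {X ∈ ℍ^{n+1} : 0 < d(P,X) ≤ t and the nearest point of P to X lies in the relative interior of the facet F(P,e_1)}, and let M(t) = (B̄_{e_1}(x_1 + t) \ B̄_{e_1}(x_1)) ∩ B̄_{e_2}(x_2). Then there exist constants C > 0 and t_0 > 0, depending only on e_1, e_2, x_1, x_2, such that V(M(t) Δ P_t) ≤ C t² for all 0 < t < t_0, where Δ denotes symmetric difference. -/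

import Mathlib

noncomputable section

open Real MeasureTheory Filter Topology Set
open scoped ENNReal symmDiff

namespace Horo

/-- The Lorentzian inner product on ℝ^{n+2}:
`X·Y = Σ_{i=1}^{n+1} x_i y_i − x_{n+2} y_{n+2}`. -/
def lprod (n : ℕ) (X Y : Fin (n + 2) → ℝ) : ℝ :=
  (∑ i : Fin (n + 1), X i.castSucc * Y i.castSucc) - X (Fin.last (n + 1)) * Y (Fin.last (n + 1))

/-- The hyperboloid model ℍ^{n+1} of hyperbolic space. -/
def Hyp (n : ℕ) : Set (Fin (n + 2) → ℝ) :=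
  {X | lprod n X X = -1 ∧ 0 < X (Fin.last (n + 1))}

/-- The origin O = (0,…,0,1) of hyperbolic space. -/
def origin (n : ℕ) : Fin (n + 2) → ℝ := Fin.snoc (fun _ => 0) 1

/-- The unit sphere 𝕊^n ⊂ ℝ^{n+1}. -/
def sph (n : ℕ) : Set (Fin (n + 1) → ℝ) := {e | ∑ i, e i ^ 2 = 1}

/-- The null vector (e,1) ∈ ℝ^{n+2} associated with e ∈ 𝕊^n. -/
def dir {n : ℕ} (e : Fin (n + 1) → ℝ) : Fin (n + 2) → ℝ := Fin.snoc e 1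

/-- The geodesic distance d(X,Y) = arcosh(−X·Y) on the hyperboloid. -/
def dH (n : ℕ) (X Y : Fin (n + 2) → ℝ) : ℝ :=
  Real.log (-(lprod n X Y) + Real.sqrt ((lprod n X Y) ^ 2 - 1))

/-- The horosphere H_e(s) = {X ∈ ℍ^{n+1} : X·(e,1) = −e^s}. -/
def horoSphere (n : ℕ) (e : Fin (n + 1) → ℝ) (s : ℝ) : Set (Fin (n + 2) → ℝ) :=
  {X ∈ Hyp n | lprod n X (dir e) = -Real.exp s}

/-- The open horo-ball B_e(s) = {X ∈ ℍ^{n+1} : 0 > X·(e,1) > −e^s}. -/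
def horoBall (n : ℕ) (e : Fin (n + 1) → ℝ) (s : ℝ) : Set (Fin (n + 2) → ℝ) :=
  {X ∈ Hyp n | 0 > lprod n X (dir e) ∧ lprod n X (dir e) > -Real.exp s}

/-- The closed horo-ball B̄_e(s) = {X ∈ ℍ^{n+1} : 0 > X·(e,1) ≥ −e^s}. -/
def horoBallCl (n : ℕ) (e : Fin (n + 1) → ℝ) (s : ℝ) : Set (Fin (n + 2) → ℝ) :=
  {X ∈ Hyp n | 0 > lprod n X (dir e) ∧ lprod n X (dir e) ≥ -Real.exp s}

/-- A set Ω ⊂ ℍ^{n+1} is horospherically convex (h-convex) if it is closed and every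
relative boundary point of Ω admits a supporting horo-ball. -/
def IsHConvex (n : ℕ) (Ω : Set (Fin (n + 2) → ℝ)) : Prop :=
  Ω ⊆ Hyp n ∧ IsClosed Ω ∧
    ∀ X ∈ Ω ∩ closure (Hyp n \ Ω),
      ∃ e ∈ sph n, ∃ s : ℝ, Ω ⊆ horoBallCl n e s ∧ X ∈ horoSphere n e s

/-- The interior of a subset of the hyperboloid, relative to the hyperboloid. -/
def relInt (n : ℕ) (K : Set (Fin (n + 2) → ℝ)) : Set (Fin (n + 2) → ℝ) :=
  {X ∈ Hyp n | ∃ ε > 0, ∀ Y ∈ Hyp n, dH n X Y < ε → Y ∈ K}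

/-- A h-convex body: a compact h-convex set with nonempty (relative) interior. -/
def IsHConvexBody (n : ℕ) (K : Set (Fin (n + 2) → ℝ)) : Prop :=
  IsHConvex n K ∧ IsCompact K ∧ (relInt n K).Nonempty

/-- A h-convex polytope: a h-convex body which is a finite intersection of closed
horo-balls. -/
def IsHPolytope (n : ℕ) (P : Set (Fin (n + 2) → ℝ)) : Prop :=
  IsHConvexBody n P ∧ ∃ m : ℕ, 2 ≤ m ∧ ∃ (e : Fin m → (Fin (n + 1) → ℝ)) (u : Fin m → ℝ),
    (∀ i, e i ∈ sph n) ∧ P = ⋂ i, horoBallCl n (e i) (u i)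

/-- The horospherical support function u(K,e) = sup{log(−X·(e,1)) : X ∈ K}. -/
def suppFn (n : ℕ) (K : Set (Fin (n + 2) → ℝ)) (e : Fin (n + 1) → ℝ) : ℝ :=
  sSup ((fun X => Real.log (-(lprod n X (dir e)))) '' K)

/-- The outer parallel set K^ε = {X ∈ ℍ^{n+1} : d(K,X) ≤ ε}. -/
def outPar (n : ℕ) (K : Set (Fin (n + 2) → ℝ)) (ε : ℝ) : Set (Fin (n + 2) → ℝ) :=
  {X ∈ Hyp n | ∃ Y ∈ K, dH n Y X ≤ ε}

/-- The Hausdorff distance d_H(K,L) = inf{ε ≥ 0 : K ⊆ L^ε and L ⊆ K^ε}. -/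
def dHaus (n : ℕ) (K L : Set (Fin (n + 2) → ℝ)) : ℝ :=
  sInf {ε : ℝ | 0 ≤ ε ∧ K ⊆ outPar n L ε ∧ L ⊆ outPar n K ε}

/-- The point (sinh r · θ, cosh r) ∈ ℍ^{n+1} at distance r from O in direction θ. -/
def rpt (n : ℕ) (θ : Fin (n + 1) → ℝ) (r : ℝ) : Fin (n + 2) → ℝ :=
  Fin.snoc (fun i => Real.sinh r * θ i) (Real.cosh r)

/-- The radial function ρ(K,θ) = max{λ ≥ 0 : (sinh λ · θ, cosh λ) ∈ K}. -/
def radFn (n : ℕ) (K : Set (Fin (n + 2) → ℝ)) (θ : Fin (n + 1) → ℝ) : ℝ :=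
  sSup {r : ℝ | 0 ≤ r ∧ rpt n θ r ∈ K}

/-- R(K) = max_θ ρ(K,θ). -/
def Rmax (n : ℕ) (K : Set (Fin (n + 2) → ℝ)) : ℝ := sSup (radFn n K '' sph n)

/-- r(K) = min_θ ρ(K,θ). -/
def rmin (n : ℕ) (K : Set (Fin (n + 2) → ℝ)) : ℝ := sInf (radFn n K '' sph n)

/-- The point reflection (x_1,…,x_{n+1},x_{n+2}) ↦ (−x_1,…,−x_{n+1},x_{n+2}) about O. -/
def symMap (n : ℕ) (X : Fin (n + 2) → ℝ) : Fin (n + 2) → ℝ :=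
  fun i => if i = Fin.last (n + 1) then X i else -X i

/-- The hyperbolic (Riemannian) volume of a subset of the hyperboloid, computed via the
graph parametrization x ↦ (x, √(1+|x|²)), whose volume density is 1/√(1+|x|²). -/
def hypVol (n : ℕ) (K : Set (Fin (n + 2) → ℝ)) : ℝ :=
  ∫ x : Fin (n + 1) → ℝ,
    Set.indicator {y : Fin (n + 1) → ℝ | Fin.snoc y (Real.sqrt (1 + ∑ i, y i ^ 2)) ∈ K}
      (fun y => 1 / Real.sqrt (1 + ∑ i, y i ^ 2)) x

/-- The distance from a point X to a set P. -/
def distTo (n : ℕ) (P : Set (Fin (n + 2) → ℝ)) (X : Fin (n + 2) → ℝ) : ℝ :=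
  sInf ((fun Y => dH n Y X) '' P)

/-- The facet F(P,e) = P ∩ H_e(u(P,e)). -/
def facet (n : ℕ) (P : Set (Fin (n + 2) → ℝ)) (e : Fin (n + 1) → ℝ) :
    Set (Fin (n + 2) → ℝ) :=
  P ∩ horoSphere n e (suppFn n P e)

/-- The relative interior of the facet F(P,e) inside the horosphere H_e(u(P,e)). -/
def facetRelInt (n : ℕ) (P : Set (Fin (n + 2) → ℝ)) (e : Fin (n + 1) → ℝ) :
    Set (Fin (n + 2) → ℝ) :=
  {Y ∈ facet n P e | ∃ δ > 0, ∀ Z ∈ horoSphere n e (suppFn n P e),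
    dH n Y Z < δ → Z ∈ facet n P e}

/-- The collar 𝒫_t(P, F̊(P,e)): points at positive distance ≤ t from P whose nearest
point in P lies in the relative interior of the facet F(P,e). -/
def collar (n : ℕ) (P : Set (Fin (n + 2) → ℝ)) (e : Fin (n + 1) → ℝ) (t : ℝ) :
    Set (Fin (n + 2) → ℝ) :=
  {X ∈ Hyp n | 0 < distTo n P X ∧ distTo n P X ≤ t ∧
    ∃ Y ∈ facetRelInt n P e, ∀ Z ∈ P, dH n Y X ≤ dH n Z X}

/-- The diameter of a set with respect to a distance function, in ℝ≥0∞. -/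
def ediamWith {α : Type*} (d : α → α → ℝ) (U : Set α) : ℝ≥0∞ :=
  ⨆ (x ∈ U) (y ∈ U), ENNReal.ofReal (d x y)

/-- The (unnormalized) s-dimensional Hausdorff measure associated with a distance
function d, via the Carathéodory construction. -/
def hMeasWith {α : Type*} (d : α → α → ℝ) (s : ℕ) (A : Set α) : ℝ≥0∞ :=
  ⨆ (δ : ℝ) (_ : 0 < δ),
    ⨅ (U : ℕ → Set α) (_ : A ⊆ ⋃ i, U i) (_ : ∀ i, ediamWith d (U i) ≤ ENNReal.ofReal δ),
      ∑' i, ediamWith d (U i) ^ s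

/-- ω_n, the volume of the unit ball in ℝ^n. -/
def unitBallVol (n : ℕ) : ℝ :=
  (volume (Metric.ball (0 : EuclideanSpace ℝ (Fin n)) 1)).toReal

/-- S(P,e): the n-dimensional area of the facet F(P,e), i.e. the normalized
n-dimensional Hausdorff measure of F(P,e) with respect to the hyperbolic distance. -/
def areaFacet (n : ℕ) (P : Set (Fin (n + 2) → ℝ)) (e : Fin (n + 1) → ℝ) : ℝ :=
  (ENNReal.ofReal (unitBallVol n / 2 ^ n) * hMeasWith (dH n) n (facet n P e)).toReal

/-! ### Lorentzian linear algebra -/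

lemma lprod_comm (n : ℕ) (X Y : Fin (n + 2) → ℝ) : lprod n X Y = lprod n Y X := by
  simp only [lprod, mul_comm]

lemma lprod_add_left (n : ℕ) (X Y Z : Fin (n + 2) → ℝ) :
    lprod n (X + Y) Z = lprod n X Z + lprod n Y Z := by
  simp only [lprod, Pi.add_apply, add_mul, Finset.sum_add_distrib]
  ring

lemma lprod_smul_left (n : ℕ) (c : ℝ) (X Z : Fin (n + 2) → ℝ) :
    lprod n (c • X) Z = c * lprod n X Z := by
  simp only [lprod, Pi.smul_apply, smul_eq_mul, mul_assoc, ← Finset.mul_sum]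
  ring

lemma lprod_add_right (n : ℕ) (X Y Z : Fin (n + 2) → ℝ) :
    lprod n Z (X + Y) = lprod n Z X + lprod n Z Y := by
  rw [lprod_comm, lprod_add_left, lprod_comm n X, lprod_comm n Y]

lemma lprod_smul_right (n : ℕ) (c : ℝ) (X Z : Fin (n + 2) → ℝ) :
    lprod n Z (c • X) = c * lprod n Z X := by
  rw [lprod_comm, lprod_smul_left, lprod_comm]

/-- The Lorentzian product with a fixed vector, as a linear functional. -/
def lprodLin (n : ℕ) (Z : Fin (n + 2) → ℝ) : (Fin (n + 2) → ℝ) →ₗ[ℝ] ℝ where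
  toFun X := lprod n X Z
  map_add' X Y := lprod_add_left n X Y Z
  map_smul' c X := lprod_smul_left n c X Z

lemma lprod_self (n : ℕ) (X : Fin (n + 2) → ℝ) :
    lprod n X X = ∑ i : Fin (n + 1), X i.castSucc ^ 2 - X (Fin.last (n + 1)) ^ 2 := by
  simp only [lprod, sq]

lemma lprod_dir (n : ℕ) (X : Fin (n + 2) → ℝ) (e : Fin (n + 1) → ℝ) :
    lprod n X (dir e) = ∑ i : Fin (n + 1), X i.castSucc * e i - X (Fin.last (n + 1)) := by
  simp [lprod, dir]

lemma lprod_dir_dir (n : ℕ) (e f : Fin (n + 1) → ℝ) :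
    lprod n (dir e) (dir f) = ∑ i, e i * f i - 1 := by
  simp [lprod, dir]

lemma lprod_dir_self {n : ℕ} {e : Fin (n + 1) → ℝ} (he : e ∈ sph n) :
    lprod n (dir e) (dir e) = 0 := by
  have : ∑ i, e i ^ 2 = 1 := he
  rw [lprod_dir_dir]
  simp only [← sq, this, sub_self]

/-- Distinct points of the sphere have null vectors with negative Lorentzian product. -/
lemma lprod_dir_dir_neg {n : ℕ} {e f : Fin (n + 1) → ℝ} (he : e ∈ sph n) (hf : f ∈ sph n)
    (hne : e ≠ f) : lprod n (dir e) (dir f) < 0 := by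
  have h1 : ∑ i, e i ^ 2 = 1 := he
  have h2 : ∑ i, f i ^ 2 = 1 := hf
  obtain ⟨i, hi⟩ := Function.ne_iff.1 hne
  have h3 : 0 < ∑ i, (e i - f i) ^ 2 :=
    Finset.sum_pos' (fun i _ => sq_nonneg _)
      ⟨i, Finset.mem_univ i, by have := sub_ne_zero.2 hi; positivity⟩
  have h4 : ∑ i, (e i - f i) ^ 2 = ∑ i, e i ^ 2 + ∑ i, f i ^ 2 - 2 * ∑ i, e i * f i := by
    rw [Finset.mul_sum, ← Finset.sum_add_distrib, ← Finset.sum_sub_distrib]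
    exact Finset.sum_congr rfl fun i _ => by ring
  rw [lprod_dir_dir]
  linarith

lemma neg_two_le_lprod_dir_dir {n : ℕ} {e f : Fin (n + 1) → ℝ} (he : e ∈ sph n)
    (hf : f ∈ sph n) : -2 ≤ lprod n (dir e) (dir f) := by
  have h1 : ∑ i, e i ^ 2 = 1 := he
  have h2 : ∑ i, f i ^ 2 = 1 := hf
  have h3 : 0 ≤ ∑ i, (e i + f i) ^ 2 := Finset.sum_nonneg fun i _ => sq_nonneg _
  have h4 : ∑ i, (e i + f i) ^ 2 = ∑ i, e i ^ 2 + ∑ i, f i ^ 2 + 2 * ∑ i, e i * f i := by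
    rw [Finset.mul_sum, ← Finset.sum_add_distrib, ← Finset.sum_add_distrib]
    exact Finset.sum_congr rfl fun i _ => by ring
  rw [lprod_dir_dir]
  linarith

/-- The reversed Cauchy–Schwarz inequality on the hyperboloid. -/
lemma lprod_le_neg_one {n : ℕ} {X Y : Fin (n + 2) → ℝ} (hX : X ∈ Hyp n) (hY : Y ∈ Hyp n) :
    lprod n X Y ≤ -1 := by
  obtain ⟨hX, hX0⟩ := hX
  obtain ⟨hY, hY0⟩ := hY
  rw [lprod_self] at hX hY
  have hcs := Finset.sum_mul_sq_le_sq_mul_sq Finset.univ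
    (fun i : Fin (n + 1) => X i.castSucc) (fun i => Y i.castSucc)
  simp only [lprod]
  set x := X (Fin.last (n + 1))
  set y := Y (Fin.last (n + 1))
  set s := ∑ i : Fin (n + 1), X i.castSucc * Y i.castSucc
  have e1 : ∑ i : Fin (n + 1), X i.castSucc ^ 2 = x ^ 2 - 1 := by linarith
  have e2 : ∑ i : Fin (n + 1), Y i.castSucc ^ 2 = y ^ 2 - 1 := by linarith
  have p1 : 0 ≤ x ^ 2 - 1 := e1 ▸ Finset.sum_nonneg fun i _ => sq_nonneg _
  have p2 : 0 ≤ y ^ 2 - 1 := e2 ▸ Finset.sum_nonneg fun i _ => sq_nonneg _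
  rw [e1, e2] at hcs
  have hx : 1 ≤ x := by nlinarith
  have hy : 1 ≤ y := by nlinarith
  have : s ≤ x * y - 1 := abs_le_of_sq_le_sq' (by nlinarith [sq_nonneg (x - y)])
    (by nlinarith) |>.2
  linarith

/-- A causal vector which is not past-directed with respect to some point of the hyperboloid is
not past-directed with respect to any null direction. -/
lemma lprod_dir_nonpos {n : ℕ} {V Y : Fin (n + 2) → ℝ} {e : Fin (n + 1) → ℝ} (he : e ∈ sph n)
    (hY : Y ∈ Hyp n) (hV : lprod n V V ≤ 0) (hVY : lprod n V Y ≤ 0) :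
    lprod n V (dir e) ≤ 0 := by
  obtain ⟨hY, hY0⟩ := hY
  have he : ∑ i, e i ^ 2 = 1 := he
  rw [lprod_self] at hV hY
  have hc1 := Finset.sum_mul_sq_le_sq_mul_sq Finset.univ
    (fun i : Fin (n + 1) => V i.castSucc) (fun i => Y i.castSucc)
  have hc2 := Finset.sum_mul_sq_le_sq_mul_sq Finset.univ
    (fun i : Fin (n + 1) => V i.castSucc) e
  rw [lprod_dir]
  simp only [lprod] at hVY
  set v := V (Fin.last (n + 1))
  set y := Y (Fin.last (n + 1))
  set s := ∑ i : Fin (n + 1), V i.castSucc * Y i.castSucc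
  set V2 := ∑ i : Fin (n + 1), V i.castSucc ^ 2
  have e2 : ∑ i : Fin (n + 1), Y i.castSucc ^ 2 = y ^ 2 - 1 := by linarith
  have p2 : 0 ≤ y ^ 2 - 1 := e2 ▸ Finset.sum_nonneg fun i _ => sq_nonneg _
  rw [e2] at hc1
  rw [he, mul_one] at hc2
  have hv : 0 ≤ v := by
    by_contra! hv
    have h1 : V2 * (y ^ 2 - 1) ≤ v ^ 2 * (y ^ 2 - 1) :=
      mul_le_mul_of_nonneg_right (by linarith) p2
    have h2 : 0 ≤ -(v * y) := by nlinarith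
    have h3 : (-(v * y)) ^ 2 ≤ (-s) ^ 2 := pow_le_pow_left₀ h2 (by linarith) 2
    nlinarith [mul_pos_of_neg_of_neg hv hv]
  have := (abs_le_of_sq_le_sq' (hc2.trans (by linarith : V2 ≤ v ^ 2)) hv).2
  linarith

lemma lprod_dir_neg {n : ℕ} {X : Fin (n + 2) → ℝ} {e : Fin (n + 1) → ℝ} (he : e ∈ sph n)
    (hX : X ∈ Hyp n) : lprod n X (dir e) < 0 := by
  obtain ⟨hX, hX0⟩ := hX
  have he : ∑ i, e i ^ 2 = 1 := he
  rw [lprod_self] at hX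
  have hc2 := Finset.sum_mul_sq_le_sq_mul_sq Finset.univ
    (fun i : Fin (n + 1) => X i.castSucc) e
  rw [lprod_dir]
  rw [he, mul_one] at hc2
  have := abs_lt_of_sq_lt_sq' (hc2.trans_lt (by linarith :
    ∑ i : Fin (n + 1), X i.castSucc ^ 2 < X (Fin.last (n + 1)) ^ 2)) hX0.le
  linarith [this.2]

/-- A unit timelike vector is future-directed once it is so with respect to a null direction. -/
lemma mem_Hyp_of_lprod_dir_neg {n : ℕ} {Z : Fin (n + 2) → ℝ} {e : Fin (n + 1) → ℝ}
    (he : e ∈ sph n) (hZ : lprod n Z Z = -1) (hZe : lprod n Z (dir e) < 0) : Z ∈ Hyp n := by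
  refine ⟨hZ, ?_⟩
  by_contra! h
  have hne : Z (Fin.last (n + 1)) ≠ 0 := by
    intro h0
    rw [lprod_self, h0] at hZ
    have : 0 ≤ ∑ i : Fin (n + 1), Z i.castSucc ^ 2 := Finset.sum_nonneg fun i _ => sq_nonneg _
    linarith
  have : (-1 : ℝ) • Z ∈ Hyp n := by
    refine ⟨by rw [lprod_smul_left, lprod_smul_right, hZ]; norm_num, ?_⟩
    have := lt_of_le_of_ne h hne
    simpa using this
  have := lprod_dir_neg he this
  rw [lprod_smul_left] at this
  linarith

/-! ### The hyperbolic distance -/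

/-- The exponential of the hyperbolic distance. -/
lemma exp_dH {n : ℕ} {X Y : Fin (n + 2) → ℝ} (hX : X ∈ Hyp n) (hY : Y ∈ Hyp n) :
    exp (dH n X Y) = -(lprod n X Y) + √((lprod n X Y) ^ 2 - 1) := by
  have := lprod_le_neg_one hX hY
  exact Real.exp_log (by linarith [Real.sqrt_nonneg ((lprod n X Y) ^ 2 - 1)])

lemma dH_comm (n : ℕ) (X Y : Fin (n + 2) → ℝ) : dH n X Y = dH n Y X := by
  rw [dH, dH, lprod_comm]

/-- Busemann functions are `1`-Lipschitz. -/
lemma neg_lprod_dir_le {n : ℕ} {X Y : Fin (n + 2) → ℝ} {e : Fin (n + 1) → ℝ} (he : e ∈ sph n)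
    (hX : X ∈ Hyp n) (hY : Y ∈ Hyp n) :
    -lprod n X (dir e) ≤ exp (dH n Y X) * -lprod n Y (dir e) := by
  have hb := lprod_le_neg_one hY hX
  have hD := exp_dH hY hX
  set b := lprod n Y X
  have hsq := Real.sq_sqrt (show 0 ≤ b ^ 2 - 1 by nlinarith)
  have hs := Real.sqrt_nonneg (b ^ 2 - 1)
  set D := exp (dH n Y X)
  have key := lprod_dir_nonpos (V := D • Y + (-1 : ℝ) • X) he hY
    (by
      simp only [lprod_add_left, lprod_smul_left, lprod_add_right, lprod_smul_right,
        lprod_comm n X Y, hX.1, hY.1]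
      change D * (D * -1 + -1 * b) + -1 * (D * b + -1 * -1) ≤ 0
      rw [hD]
      nlinarith)
    (by
      simp only [lprod_add_left, lprod_smul_left, lprod_comm n X Y, hY.1]
      change D * -1 + -1 * b ≤ 0
      linarith)
  rw [lprod_add_left, lprod_smul_left, lprod_smul_left] at key
  linarith

lemma dH_lt_dH {n : ℕ} {X Y Z W : Fin (n + 2) → ℝ} (hX : X ∈ Hyp n) (hY : Y ∈ Hyp n)
    (h : lprod n Z W < lprod n X Y) : dH n X Y < dH n Z W := by
  have h1 := lprod_le_neg_one hX hY
  have h2 : (lprod n X Y) ^ 2 - 1 ≤ (lprod n Z W) ^ 2 - 1 := by nlinarith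
  have h3 := Real.sqrt_le_sqrt h2
  exact Real.log_lt_log (by linarith [Real.sqrt_nonneg ((lprod n X Y) ^ 2 - 1)]) (by linarith)

lemma dH_eq_of_lprod_eq_neg_cosh {n : ℕ} {X Y : Fin (n + 2) → ℝ} {s : ℝ} (hs : 0 ≤ s)
    (h : lprod n X Y = -cosh s) : dH n X Y = s := by
  have h1 : √((-cosh s) ^ 2 - 1) = sinh s := by
    rw [neg_sq, Real.cosh_sq, add_sub_cancel_right, Real.sqrt_sq (Real.sinh_nonneg_iff.2 hs)]
  rw [dH, h, h1, neg_neg, Real.cosh_add_sinh, Real.log_exp]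

/-! ### Horo-balls -/

lemma mem_horoBallCl {n : ℕ} {X : Fin (n + 2) → ℝ} {e : Fin (n + 1) → ℝ} {s : ℝ}
    (he : e ∈ sph n) : X ∈ horoBallCl n e s ↔ X ∈ Hyp n ∧ -lprod n X (dir e) ≤ exp s := by
  constructor
  · rintro ⟨h1, -, h2⟩
    exact ⟨h1, by linarith⟩
  · rintro ⟨h1, h2⟩
    exact ⟨h1, lprod_dir_neg he h1, by linarith⟩

/-- The horosphere bounding the first horo-ball contains a point of the second one. -/
lemma exists_mem_horoSphere_inter {n : ℕ} {e₁ e₂ : Fin (n + 1) → ℝ} (he₁ : e₁ ∈ sph n)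
    (he₂ : e₂ ∈ sph n) (hne : e₁ ≠ e₂) {x₁ x₂ : ℝ} (hx₁ : 0 < x₁) (hx₂ : 0 < x₂) :
    ∃ X ∈ horoBallCl n e₂ x₂, X ∈ horoSphere n e₁ x₁ := by
  have hc := lprod_dir_dir_neg he₁ he₂ hne
  have hc2 := neg_two_le_lprod_dir_dir he₁ he₂
  set k := lprod n (dir e₁) (dir e₂) with hk
  have hk0 : k ≠ 0 := hc.ne
  set X : Fin (n + 2) → ℝ := (exp (-x₁) / 2) • dir e₁ + (-(exp x₁) / k) • dir e₂ with hX
  have hE : exp (-x₁) * exp x₁ = 1 := by rw [← Real.exp_add]; simp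
  have h1 : lprod n X (dir e₁) = -exp x₁ := by
    rw [hX, lprod_add_left, lprod_smul_left, lprod_smul_left, lprod_dir_self he₁,
      lprod_comm n (dir e₂), ← hk]
    field_simp
    ring
  have h2 : lprod n X (dir e₂) = exp (-x₁) / 2 * k := by
    rw [hX, lprod_add_left, lprod_smul_left, lprod_smul_left, lprod_dir_self he₂, ← hk]
    ring
  have h3 : lprod n X X = -1 := by
    conv_lhs => rw [hX, lprod_add_right, lprod_smul_right, lprod_smul_right, ← hX, h1, h2]
    field_simp
    linarith
  have h4 : X ∈ Hyp n := mem_Hyp_of_lprod_dir_neg he₁ h3 (by rw [h1]; simp [Real.exp_pos])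
  refine ⟨X, (mem_horoBallCl he₂).2 ⟨h4, ?_⟩, h4, h1⟩
  rw [h2]
  have h5 : exp (-x₁) ≤ 1 := Real.exp_le_one_iff.2 (by linarith)
  have h6 : 1 ≤ exp x₂ := Real.one_le_exp hx₂.le
  nlinarith [Real.exp_pos (-x₁)]

lemma suppFn_inter {n : ℕ} {e₁ e₂ : Fin (n + 1) → ℝ} (he₁ : e₁ ∈ sph n)
    (he₂ : e₂ ∈ sph n) (hne : e₁ ≠ e₂) {x₁ x₂ : ℝ} (hx₁ : 0 < x₁) (hx₂ : 0 < x₂) :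
    suppFn n (horoBallCl n e₁ x₁ ∩ horoBallCl n e₂ x₂) e₁ = x₁ := by
  refine IsGreatest.csSup_eq ⟨?_, ?_⟩
  · obtain ⟨X, hX2, hX, hX1⟩ := exists_mem_horoSphere_inter he₁ he₂ hne hx₁ hx₂
    refine ⟨X, ⟨(mem_horoBallCl he₁).2 ⟨hX, by rw [hX1, neg_neg]⟩, hX2⟩, ?_⟩
    simp [hX1]
  · rintro _ ⟨X, ⟨hX, -⟩, rfl⟩
    rw [mem_horoBallCl he₁] at hX
    refine (Real.log_le_iff_le_exp ?_).2 hX.2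
    linarith [lprod_dir_neg he₁ hX.1]

/-- On a horosphere centred at `e₁`, the Busemann function of another direction `e₂` has no local
maximum. -/
lemma exists_horoSphere_near {n : ℕ} (hn : 1 ≤ n) {e₁ e₂ : Fin (n + 1) → ℝ} (he₁ : e₁ ∈ sph n)
    (he₂ : e₂ ∈ sph n) (hne : e₁ ≠ e₂) {s : ℝ} {Y : Fin (n + 2) → ℝ}
    (hY : Y ∈ horoSphere n e₁ s) {δ : ℝ} (hδ : 0 < δ) :
    ∃ Z ∈ horoSphere n e₁ s, dH n Y Z < δ ∧ -lprod n Y (dir e₂) < -lprod n Z (dir e₂) := by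
  obtain ⟨hYH, hY1⟩ := hY
  have hk := lprod_dir_dir_neg he₁ he₂ hne
  obtain ⟨v, hv0, hvY, hv1, hv2⟩ : ∃ v : Fin (n + 2) → ℝ, v ≠ 0 ∧ lprod n v Y = 0 ∧
      lprod n v (dir e₁) = 0 ∧ lprod n v (dir e₂) ≤ 0 := by
    have hker : LinearMap.ker ((lprodLin n Y).prod (lprodLin n (dir e₁))) ≠ ⊥ := by
      apply LinearMap.ker_ne_bot_of_finrank_lt
      simp
      omega
    obtain ⟨v, hv, hv0⟩ := Submodule.exists_mem_ne_zero_of_ne_bot hker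
    have hv' : lprod n v Y = 0 ∧ lprod n v (dir e₁) = 0 := by
      simpa [lprodLin, Prod.ext_iff] using hv
    rcases le_total (lprod n v (dir e₂)) 0 with h | h
    · exact ⟨v, hv0, hv'.1, hv'.2, h⟩
    · refine ⟨(-1 : ℝ) • v, by simpa using hv0, ?_, ?_, ?_⟩ <;> rw [lprod_smul_left] <;>
        simp [hv', h]
  have hq : 0 < lprod n v v := by
    by_contra! h
    rw [lprod_self] at h
    have hc := Finset.sum_mul_sq_le_sq_mul_sq Finset.univ
      (fun i : Fin (n + 1) => v i.castSucc) (fun i => Y i.castSucc)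
    have hy := hYH.1
    rw [lprod_self] at hy
    simp only [lprod] at hvY
    set w := v (Fin.last (n + 1))
    set y := Y (Fin.last (n + 1))
    set V2 := ∑ i : Fin (n + 1), v i.castSucc ^ 2
    have hV2 : 0 ≤ V2 := Finset.sum_nonneg fun i _ => sq_nonneg _
    have e1 : ∑ i : Fin (n + 1), v i.castSucc * Y i.castSucc = w * y := by linarith
    have e2 : ∑ i : Fin (n + 1), Y i.castSucc ^ 2 = y ^ 2 - 1 := by linarith
    rw [e1, e2] at hc
    have p2 : 0 ≤ y ^ 2 - 1 := e2 ▸ Finset.sum_nonneg fun i _ => sq_nonneg _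
    have hw : w ^ 2 ≤ 0 := by nlinarith
    have hw0 : w = 0 := by nlinarith
    have hV0 : V2 = 0 := by nlinarith
    apply hv0
    funext i
    refine Fin.lastCases hw0 (fun i => ?_) i
    have := (Finset.sum_eq_zero_iff_of_nonneg (fun i _ => sq_nonneg _)).1 hV0 i
      (Finset.mem_univ i)
    simpa using this
  set q := lprod n v v with hqdef
  have hcont : ContinuousAt (fun ε : ℝ => Real.log ((1 + ε ^ 2 * q / 2) +
      √((-(1 + ε ^ 2 * q / 2)) ^ 2 - 1))) 0 := by
    apply ContinuousAt.log
    · fun_prop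
    · simp
  have hev : ∀ᶠ ε in 𝓝[>] (0 : ℝ), Real.log ((1 + ε ^ 2 * q / 2) +
      √((-(1 + ε ^ 2 * q / 2)) ^ 2 - 1)) < δ := by
    refine (hcont.eventually_lt_const ?_).filter_mono nhdsWithin_le_nhds
    simpa using hδ
  obtain ⟨ε, hε, hε0⟩ := (hev.and self_mem_nhdsWithin).exists
  have hε0 : 0 < ε := hε0
  set a := exp s
  have ha : 0 < a := Real.exp_pos s
  set Z := Y + (ε • v + (ε ^ 2 * q / (2 * a)) • dir e₁) with hZ
  have hZY : lprod n Y Z = -(1 + ε ^ 2 * q / 2) := by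
    rw [hZ, lprod_add_right, lprod_add_right, lprod_smul_right, lprod_smul_right, hYH.1,
      lprod_comm n Y v, hvY, hY1]
    field_simp
    ring
  have hZ1 : lprod n Z (dir e₁) = -a := by
    rw [hZ, lprod_add_left, lprod_add_left, lprod_smul_left, lprod_smul_left,
      lprod_dir_self he₁, hv1, hY1]
    ring
  have hZv : lprod n Z v = ε * q := by
    rw [hZ, lprod_add_left, lprod_add_left, lprod_smul_left, lprod_smul_left,
      lprod_comm n Y v, lprod_comm n (dir e₁), hvY, hv1, ← hqdef]
    ring
  have hZ2 : lprod n Z (dir e₂) = lprod n Y (dir e₂) + ε * lprod n v (dir e₂) +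
      ε ^ 2 * q / (2 * a) * lprod n (dir e₁) (dir e₂) := by
    rw [hZ, lprod_add_left, lprod_add_left, lprod_smul_left, lprod_smul_left]
    ring
  have hZZ : lprod n Z Z = -1 := by
    conv_lhs => rw [hZ, lprod_add_right, lprod_add_right, lprod_smul_right, lprod_smul_right,
      ← hZ, hZ1, hZv, lprod_comm, hZY]
    field_simp
    ring
  refine ⟨Z, ⟨mem_Hyp_of_lprod_dir_neg he₁ hZZ (by rw [hZ1]; linarith), hZ1⟩, ?_, ?_⟩
  · rw [dH, hZY, neg_neg]
    exact hε
  · have h1 : 0 < ε ^ 2 * q / (2 * a) := by positivity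
    rw [hZ2]
    nlinarith

/-- A point of the horo-ball at `e₁` whose nearest point in the intersection of two horo-balls
lies in the interior of the second one belongs to the intersection. -/
lemma exists_closer {n : ℕ} {e₁ e₂ : Fin (n + 1) → ℝ} (he₁ : e₁ ∈ sph n)
    (he₂ : e₂ ∈ sph n) {x₁ x₂ : ℝ} {X Y : Fin (n + 2) → ℝ}
    (hY : Y ∈ horoBallCl n e₁ x₁) (hX : X ∈ horoBallCl n e₁ x₁)
    (hY2 : -lprod n Y (dir e₂) < exp x₂) (hd : 0 < dH n Y X) :
    ∃ Z ∈ horoBallCl n e₁ x₁ ∩ horoBallCl n e₂ x₂, dH n Z X < dH n Y X := by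
  rw [mem_horoBallCl he₁] at hX hY
  obtain ⟨hXH, hX1⟩ := hX
  obtain ⟨hYH, hY1⟩ := hY
  have hb : 1 < -lprod n Y X := by
    rcases (lprod_le_neg_one hYH hXH).lt_or_eq with h | h
    · linarith
    · rw [dH, h] at hd
      simp at hd
  set b := -lprod n Y X with hbdef
  have hu := lprod_dir_neg he₂ hYH
  have hw := lprod_dir_neg he₂ hXH
  set u := -lprod n Y (dir e₂) with hudef
  set w := -lprod n X (dir e₂) with hwdef
  have hu0 : 0 < u := by linarith
  have hw0 : 0 < w := by linarith
  set τ := (exp x₂ - u) / (exp x₂ - u + w) with hτ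
  have hden : 0 < exp x₂ - u + w := by linarith
  have hτ0 : 0 < τ := div_pos (by linarith) hden
  have hτ1 : τ < 1 := (div_lt_one hden).2 (by linarith)
  have hτw : τ * (exp x₂ - u + w) = exp x₂ - u := div_mul_cancel₀ _ hden.ne'
  set N := 1 + 2 * τ * (1 - τ) * (b - 1) with hN
  have hN1 : 1 ≤ N := by
    have := mul_nonneg (mul_nonneg hτ0.le (sub_nonneg.2 hτ1.le)) (sub_nonneg.2 hb.le)
    nlinarith
  have hr1 : 1 ≤ √N := Real.one_le_sqrt.2 hN1
  have hr : √N ^ 2 = N := Real.sq_sqrt (by linarith)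
  set r := √N
  have hr0 : 0 < r := by linarith
  set Z := r⁻¹ • ((1 - τ) • Y + τ • X) with hZ
  have hZl : ∀ W, lprod n Z W = ((1 - τ) * lprod n Y W + τ * lprod n X W) / r := by
    intro W
    rw [hZ, lprod_smul_left, lprod_add_left, lprod_smul_left, lprod_smul_left]
    field_simp
  have hZle : ∀ W c, (1 - τ) * -lprod n Y W + τ * -lprod n X W ≤ c → 0 ≤ c →
      -lprod n Z W ≤ c := by
    intro W c h hc
    rw [hZl, ← neg_div, div_le_iff₀ hr0]
    nlinarith
  have hZZ : lprod n Z Z = -1 := by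
    rw [hZl, lprod_comm n Y, lprod_comm n X, hZl, hZl, hXH.1, hYH.1, lprod_comm n X Y,
      show lprod n Y X = -b by rw [hbdef, neg_neg]]
    field_simp
    rw [hr, hN]
    ring
  have hZH : Z ∈ Hyp n := by
    refine mem_Hyp_of_lprod_dir_neg he₂ hZZ ?_
    rw [hZl]
    refine div_neg_of_neg_of_pos ?_ hr0
    nlinarith
  refine ⟨Z, ⟨(mem_horoBallCl he₁).2 ⟨hZH, hZle _ _ ?_ (Real.exp_pos _).le⟩,
    (mem_horoBallCl he₂).2 ⟨hZH, hZle _ _ ?_ (Real.exp_pos _).le⟩⟩, dH_lt_dH hZH hXH ?_⟩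
  · nlinarith
  · nlinarith
  · have : -lprod n Z X < b := by
      rw [hZl, ← neg_div, div_lt_iff₀ hr0, hXH.1]
      nlinarith
    linarith

/-- Every point of the symmetric difference of the slab and the collar lies close to the
intersection of the two bounding horospheres. -/
lemma symmDiff_collar_subset {n : ℕ} (hn : 1 ≤ n) {e₁ e₂ : Fin (n + 1) → ℝ} (he₁ : e₁ ∈ sph n)
    (he₂ : e₂ ∈ sph n) (hne : e₁ ≠ e₂) {x₁ x₂ : ℝ} (hx₁ : 0 < x₁) (hx₂ : 0 < x₂) {t : ℝ}
    (ht : 0 < t) {X : Fin (n + 2) → ℝ}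
    (hX : X ∈ ((horoBallCl n e₁ (x₁ + t) \ horoBallCl n e₁ x₁) ∩ horoBallCl n e₂ x₂) ∆
      collar n (horoBallCl n e₁ x₁ ∩ horoBallCl n e₂ x₂) e₁ t) :
    exp x₁ < -lprod n X (dir e₁) ∧ -lprod n X (dir e₁) ≤ exp (x₁ + t) ∧
      exp (x₂ - t) ≤ -lprod n X (dir e₂) ∧ -lprod n X (dir e₂) ≤ exp (x₂ + t) := by
  have hsupp := suppFn_inter he₁ he₂ hne hx₁ hx₂
  rcases hX with ⟨⟨⟨hX1, hX1'⟩, hX2⟩, hXc⟩ | ⟨hXc, hXM⟩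
  · rw [mem_horoBallCl he₁] at hX1 hX1'
    rw [mem_horoBallCl he₂] at hX2
    have hXH := hX1.1
    have hgt : exp x₁ < -lprod n X (dir e₁) := by
      by_contra! h
      exact hX1' ⟨hXH, h⟩
    refine ⟨hgt, hX1.2, ?_, hX2.2.trans (Real.exp_le_exp.2 (by linarith))⟩
    by_contra! hlt
    apply hXc
    set a := -lprod n X (dir e₁) with ha
    have ha0 : 0 < a := (Real.exp_pos _).trans hgt
    set s := Real.log a - x₁ with hs
    have hs0 : 0 < s := sub_pos.2 ((Real.lt_log_iff_exp_lt ha0).2 hgt)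
    have hst : s ≤ t := by
      have := (Real.log_le_iff_le_exp ha0).2 hX1.2
      linarith
    have hsa : a = exp s * exp x₁ := by
      rw [← Real.exp_add, hs, sub_add_cancel, Real.exp_log ha0]
    have hE : exp (-s) * exp s = 1 := by rw [← Real.exp_add]; simp
    set Y := exp (-s) • X + (sinh s / a) • dir e₁ with hY
    have hYX : lprod n Y X = -cosh s := by
      rw [hY, lprod_add_left, lprod_smul_left, lprod_smul_left, hXH.1, lprod_comm,
        show lprod n X (dir e₁) = -a by rw [ha, neg_neg], Real.cosh_eq, Real.sinh_eq]
      field_simp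
      ring
    have hY1 : lprod n Y (dir e₁) = -exp x₁ := by
      rw [hY, lprod_add_left, lprod_smul_left, lprod_smul_left, lprod_dir_self he₁,
        show lprod n X (dir e₁) = -a by rw [ha, neg_neg], hsa]
      linear_combination (-exp x₁) * hE
    have hYY : lprod n Y Y = -1 := by
      conv_lhs => rw [hY, lprod_add_right, lprod_smul_right, lprod_smul_right, ← hY, hYX, hY1,
        hsa, Real.cosh_eq, Real.sinh_eq]
      field_simp
      linear_combination (-exp s - exp (-s)) * hE
    have hYH : Y ∈ Hyp n :=
      mem_Hyp_of_lprod_dir_neg he₁ hYY (by rw [hY1]; simp [Real.exp_pos])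
    have hdYX : dH n Y X = s := dH_eq_of_lprod_eq_neg_cosh hs0.le hYX
    have hY2 : -lprod n Y (dir e₂) < exp x₂ := by
      have h1 := neg_lprod_dir_le he₂ hYH hXH
      rw [dH_comm, hdYX] at h1
      calc _ ≤ _ := h1
        _ < exp s * exp (x₂ - t) := mul_lt_mul_of_pos_left hlt (Real.exp_pos s)
        _ ≤ exp x₂ := by rw [← Real.exp_add]; exact Real.exp_le_exp.2 (by linarith)
    have hYP : Y ∈ horoBallCl n e₁ x₁ ∩ horoBallCl n e₂ x₂ :=
      ⟨(mem_horoBallCl he₁).2 ⟨hYH, by rw [hY1, neg_neg]⟩,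
        (mem_horoBallCl he₂).2 ⟨hYH, hY2.le⟩⟩
    have hmin : ∀ Z ∈ horoBallCl n e₁ x₁ ∩ horoBallCl n e₂ x₂, dH n Y X ≤ dH n Z X := by
      rintro Z ⟨hZ, -⟩
      rw [mem_horoBallCl he₁] at hZ
      have h1 := neg_lprod_dir_le he₁ hXH hZ.1
      have h2 : exp s * exp x₁ ≤ exp (dH n Z X) * exp x₁ := by
        rw [← hsa]
        exact h1.trans (mul_le_mul_of_nonneg_left hZ.2 (Real.exp_pos _).le)
      rw [hdYX]
      exact Real.exp_le_exp.1 (le_of_mul_le_mul_right h2 (Real.exp_pos _))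
    have hdist : distTo n (horoBallCl n e₁ x₁ ∩ horoBallCl n e₂ x₂) X = s := by
      rw [← hdYX]
      refine IsLeast.csInf_eq ⟨⟨Y, hYP, rfl⟩, ?_⟩
      rintro _ ⟨Z, hZ, rfl⟩
      exact hmin Z hZ
    have hY20 : 0 < -lprod n Y (dir e₂) := by linarith [lprod_dir_neg he₂ hYH]
    refine ⟨hXH, by rwa [hdist], by rwa [hdist], Y, ⟨⟨hYP, hYH, by rw [hsupp, hY1]⟩,
      x₂ - Real.log (-lprod n Y (dir e₂)),
      sub_pos.2 ((Real.log_lt_iff_lt_exp hY20).2 hY2), ?_⟩, hmin⟩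
    rintro Z ⟨hZH, hZ1⟩ hZd
    refine ⟨⟨(mem_horoBallCl he₁).2 ⟨hZH, by rw [hZ1, hsupp, neg_neg]⟩,
      (mem_horoBallCl he₂).2 ⟨hZH, (neg_lprod_dir_le he₂ hZH hYH).trans ?_⟩⟩, hZH, hZ1⟩
    rw [← Real.exp_log hY20, ← Real.exp_add]
    exact Real.exp_le_exp.2 (by linarith)
  · obtain ⟨hXH, hd0, hdt, Y, ⟨⟨⟨hYP1, hYP2⟩, hYS⟩, δ, hδ, hnear⟩, hmin⟩ := hXc
    rw [hsupp] at hYS hnear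
    have hdist : distTo n (horoBallCl n e₁ x₁ ∩ horoBallCl n e₂ x₂) X = dH n Y X := by
      refine IsLeast.csInf_eq ⟨⟨Y, ⟨hYP1, hYP2⟩, rfl⟩, ?_⟩
      rintro _ ⟨Z, hZ, rfl⟩
      exact hmin Z hZ
    rw [hdist] at hd0 hdt
    have hYH := hYP1.1
    have hY2 : -lprod n Y (dir e₂) < exp x₂ := by
      obtain ⟨Z, hZ, hZd, hZ2⟩ := exists_horoSphere_near hn he₁ he₂ hne hYS hδ
      exact hZ2.trans_le ((mem_horoBallCl he₂).1 (hnear Z hZ hZd).1.2).2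
    have hX1 : X ∉ horoBallCl n e₁ x₁ := by
      intro hX1
      obtain ⟨Z, hZ, hZd⟩ := exists_closer he₁ he₂ hYP1 hX1 hY2 hd0
      exact absurd (hmin Z hZ) (not_le.2 hZd)
    have hup : ∀ e ∈ sph n, ∀ x, Y ∈ horoBallCl n e x → -lprod n X (dir e) ≤ exp (x + t) := by
      intro e he x hYe
      refine (neg_lprod_dir_le he hXH hYH).trans ?_
      rw [add_comm, Real.exp_add]
      exact mul_le_mul (Real.exp_le_exp.2 hdt) ((mem_horoBallCl he).1 hYe).2
        (by linarith [lprod_dir_neg he hYH]) (Real.exp_pos _).le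
    have hX1t := hup e₁ he₁ x₁ hYP1
    refine ⟨?_, hX1t, ?_, hup e₂ he₂ x₂ hYP2⟩
    · by_contra! h
      exact hX1 ((mem_horoBallCl he₁).2 ⟨hXH, h⟩)
    · by_contra! h
      exact hXM ⟨⟨(mem_horoBallCl he₁).2 ⟨hXH, hX1t⟩, hX1⟩,
        (mem_horoBallCl he₂).2 ⟨hXH, h.le.trans (Real.exp_le_exp.2 (by linarith))⟩⟩

/-! ### Volume estimates in `ℝ^{n+1}` -/

lemma one_add_pow_le (n : ℕ) {x : ℝ} (hx0 : 0 ≤ x) (hx1 : x ≤ 1) :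
    (1 + x) ^ n ≤ 1 + (2 ^ n - 1) * x := by
  induction n with
  | zero => simp
  | succ n ih =>
    have h2 : (1 : ℝ) ≤ 2 ^ n := one_le_pow₀ one_le_two
    rw [pow_succ, pow_succ]
    nlinarith [mul_nonneg (mul_nonneg (sub_nonneg.2 h2) hx0) (sub_nonneg.2 hx1)]

/-- The part of a large cube between two parallel hyperplanes has volume at most proportional to
their distance. -/
lemma exists_volume_slab_le {n : ℕ} (p : (Fin (n + 1) → ℝ) →ₗ[ℝ] ℝ) (hp : p ≠ 0) {R : ℝ}
    (hR : 0 ≤ R) : ∃ K : ℝ, 0 < K ∧ ∀ q ρ : ℝ, 0 ≤ ρ →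
      volume {y : Fin (n + 1) → ℝ | (∀ i, |y i| ≤ R) ∧ |p y - q| ≤ ρ} ≤ ENNReal.ofReal (K * ρ) := by
  classical
  obtain ⟨i₀, hi₀⟩ : ∃ i, p (Pi.single i 1) ≠ 0 := by
    by_contra! h
    exact hp (LinearMap.pi_ext' fun i => LinearMap.ext_ring (by simpa using h i))
  set c := p (Pi.single i₀ 1) with hc
  set M : (Fin (n + 1) → ℝ) →ₗ[ℝ] (Fin (n + 1) → ℝ) :=
    LinearMap.transvection (p - LinearMap.proj i₀) (Pi.single i₀ 1) with hM
  have hdet : LinearMap.det M = c := by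
    rw [hM, LinearMap.transvection.det]
    simp [← hc]
  have hMi : ∀ y, M y i₀ = p y := by
    intro y
    simp [hM, LinearMap.transvection.apply]
  have hMj : ∀ y i, i ≠ i₀ → M y i = y i := by
    intro y i hi
    simp [hM, LinearMap.transvection.apply, hi]
  refine ⟨|c⁻¹| * (2 * (2 * R + 1) ^ n), by positivity, fun q ρ hρ => ?_⟩
  have hsub : {y : Fin (n + 1) → ℝ | (∀ i, |y i| ≤ R) ∧ |p y - q| ≤ ρ} ⊆
      M ⁻¹' Icc (fun i => if i = i₀ then q - ρ else -R) (fun i => if i = i₀ then q + ρ else R) := by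
    rintro y ⟨h1, h2⟩
    have h2 := abs_le.1 h2
    refine ⟨fun i => ?_, fun i => ?_⟩ <;> by_cases hi : i = i₀
    · subst hi
      simp only [if_true, hMi]
      linarith
    · simp only [if_neg hi, hMj y i hi]
      exact (abs_le.1 (h1 i)).1
    · subst hi
      simp only [if_true, hMi]
      linarith
    · simp only [if_neg hi, hMj y i hi]
      exact (abs_le.1 (h1 i)).2
  refine (measure_mono hsub).trans ?_
  rw [Measure.addHaar_preimage_linearMap _ (by rw [hdet]; exact hi₀), hdet, Real.volume_Icc_pi,
    ← ENNReal.ofReal_prod_of_nonneg, ← ENNReal.ofReal_mul (abs_nonneg _)]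
  · apply ENNReal.ofReal_le_ofReal
    rw [mul_assoc]
    refine mul_le_mul_of_nonneg_left ?_ (abs_nonneg _)
    rw [Fintype.prod_eq_mul_prod_compl i₀]
    have : ∏ i ∈ {i₀}ᶜ, ((if i = i₀ then q + ρ else R) - (if i = i₀ then q - ρ else -R)) =
        (2 * R) ^ n := by
      rw [Finset.prod_congr rfl (g := fun _ => 2 * R)]
      · simp [Finset.card_compl]
      · intro i hi
        have : i ≠ i₀ := by simpa using hi
        simp only [if_neg this]
        ring
    rw [this]
    simp only [if_true]
    have : (2 * R) ^ n ≤ (2 * R + 1) ^ n := pow_le_pow_left₀ (by positivity) (by linarith) n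
    nlinarith
  · intro i _
    split_ifs <;> linarith

/-- Sublevel sets of a convex function, cut by a slab: raising the level enlarges the volume at
most like a dilation along the hyperplanes of the slab. -/
lemma volume_sublevel_le {n : ℕ} {g : (Fin (n + 1) → ℝ) → ℝ} (hg : ConvexOn ℝ univ g)
    (p : (Fin (n + 1) → ℝ) →ₗ[ℝ] ℝ) {y₁ : Fin (n + 1) → ℝ} (hp : p y₁ = 1) {A η δ ρ : ℝ}
    (hη : 0 < η) (hδ : 0 ≤ δ) (h : ∀ s, |s| ≤ ρ → g (s • y₁) ≤ A - η) :
    volume {y | |p y| ≤ ρ ∧ g y ≤ A + δ} ≤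
      ENNReal.ofReal ((1 + δ / η) ^ n) * volume {y | |p y| ≤ ρ ∧ g y ≤ A} := by
  set l := 1 + δ / η with hl
  have hl1 : 1 ≤ l := le_add_of_nonneg_right (by positivity)
  have hl0 : 0 < l := by linarith
  have hlη : l * η = η + δ := by rw [hl]; field_simp
  set M : (Fin (n + 1) → ℝ) →ₗ[ℝ] (Fin (n + 1) → ℝ) :=
    l⁻¹ • LinearMap.transvection ((l - 1) • p) y₁ with hM
  have hdet : LinearMap.det M = (l ^ n)⁻¹ := by
    rw [hM, LinearMap.det_smul, LinearMap.transvection.det]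
    simp only [Module.finrank_fintype_fun_eq_card, Fintype.card_fin, LinearMap.smul_apply, hp,
      smul_eq_mul]
    rw [mul_one, add_sub_cancel, pow_succ, mul_assoc, inv_mul_cancel₀ hl0.ne', mul_one, inv_pow]
  have hMy : ∀ y, M y = (1 - l⁻¹) • (p y • y₁) + l⁻¹ • y := by
    intro y
    have hl' : l⁻¹ * (l - 1) = 1 - l⁻¹ := by field_simp
    simp only [hM, LinearMap.smul_apply, LinearMap.transvection.apply, smul_add, smul_smul,
      smul_eq_mul]
    rw [← mul_assoc, hl', add_comm (l⁻¹ • y)]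
  have hpM : ∀ y, p (M y) = p y := by
    intro y
    simp only [hMy, map_add, map_smul, hp, smul_eq_mul]
    ring
  have hsub : {y | |p y| ≤ ρ ∧ g y ≤ A + δ} ⊆ M ⁻¹' {y | |p y| ≤ ρ ∧ g y ≤ A} := by
    rintro y ⟨h1, h2⟩
    refine ⟨by rwa [hpM], ?_⟩
    have hli : l⁻¹ ≤ 1 := inv_le_one_of_one_le₀ hl1
    have hli0 : 0 < l⁻¹ := inv_pos.2 hl0
    have h3 := hg.2 (mem_univ (p y • y₁)) (mem_univ y) (sub_nonneg.2 hli) hli0.le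
      (sub_add_cancel 1 l⁻¹)
    rw [← hMy, smul_eq_mul, smul_eq_mul] at h3
    have h4 := mul_le_mul_of_nonneg_left (h _ h1) (sub_nonneg.2 hli)
    have h5 := mul_le_mul_of_nonneg_left h2 hli0.le
    have h6 : l⁻¹ * (η + δ) = η := by rw [← hlη, inv_mul_cancel_left₀ hl0.ne']
    linarith
  refine (measure_mono hsub).trans (le_of_eq ?_)
  rw [Measure.addHaar_preimage_linearMap _ (by rw [hdet]; positivity), hdet, inv_inv,
    abs_of_pos (by positivity)]

lemma volume_shell_le {n : ℕ} {g : (Fin (n + 1) → ℝ) → ℝ} (hg : ConvexOn ℝ univ g)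
    (hgc : Continuous g) (p : (Fin (n + 1) → ℝ) →ₗ[ℝ] ℝ) {y₀ y₁ : Fin (n + 1) → ℝ}
    (hp : p y₁ = 1) {A η δ ρ K : ℝ} (hη : 0 < η) (hδ : 0 ≤ δ) (hδη : δ ≤ η)
    (h : ∀ s, |s| ≤ ρ → g (y₀ + s • y₁) ≤ A - η)
    (hvol : volume {y | |p y - p y₀| ≤ ρ ∧ g y ≤ A} ≤ ENNReal.ofReal K) :
    volume {y | |p y - p y₀| ≤ ρ ∧ A < g y ∧ g y ≤ A + δ} ≤
      ENNReal.ofReal (2 ^ n * (δ / η) * K) := by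
  have hpc : Continuous p := p.continuous_of_finiteDimensional
  have htr : ∀ s, volume {y | |p y| ≤ ρ ∧ g (y₀ + y) ≤ s} =
      volume {y | |p y - p y₀| ≤ ρ ∧ g y ≤ s} := by
    intro s
    rw [← measure_preimage_add volume y₀ {y | |p y - p y₀| ≤ ρ ∧ g y ≤ s}]
    simp only [preimage_ofPred_eq, map_add, add_sub_cancel_left]
  have hg' : ConvexOn ℝ univ (fun y => g (y₀ + y)) := by
    simpa [Function.comp_def] using hg.translate_right y₀
  have hle := volume_sublevel_le hg' p hp hη hδ h
  rw [htr, htr] at hle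
  have hmeas : MeasurableSet {y | |p y - p y₀| ≤ ρ ∧ g y ≤ A} :=
    (isClosed_le (hpc.sub continuous_const).abs continuous_const).measurableSet.inter
      (isClosed_le hgc continuous_const).measurableSet
  have hsub : {y | |p y - p y₀| ≤ ρ ∧ g y ≤ A} ⊆ {y | |p y - p y₀| ≤ ρ ∧ g y ≤ A + δ} :=
    fun y hy => ⟨hy.1, hy.2.trans (by linarith)⟩
  have hshell : {y | |p y - p y₀| ≤ ρ ∧ A < g y ∧ g y ≤ A + δ} =
      {y | |p y - p y₀| ≤ ρ ∧ g y ≤ A + δ} \ {y | |p y - p y₀| ≤ ρ ∧ g y ≤ A} := by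
    ext y
    simp only [mem_ofPred_eq, Set.mem_sdiff, not_and, not_le]
    tauto
  have hfin := ne_top_of_le_ne_top ENNReal.ofReal_ne_top hvol
  rw [hshell, measure_sdiff hsub hmeas.nullMeasurableSet hfin, tsub_le_iff_right]
  refine hle.trans ?_
  have hx0 : 0 ≤ δ / η := by positivity
  have hpow := one_add_pow_le n hx0 ((div_le_one hη).2 hδη)
  calc _ ≤ ENNReal.ofReal (2 ^ n * (δ / η) + 1) * volume {y | |p y - p y₀| ≤ ρ ∧ g y ≤ A} := by
        gcongr
        linarith
    _ ≤ _ := by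
        rw [ENNReal.ofReal_add (by positivity) zero_le_one, ENNReal.ofReal_one, add_mul, one_mul,
          ENNReal.ofReal_mul (p := 2 ^ n * (δ / η)) (by positivity)]
        gcongr

/-! ### Busemann functions in the graph parametrization -/

/-- The function `y ↦ −X·(e,1)`, where `X` is the point of the hyperboloid above `y`. -/
def busemannExp {n : ℕ} (e y : Fin (n + 1) → ℝ) : ℝ :=
  √(1 + ∑ i, y i ^ 2) - ∑ i, y i * e i

lemma snoc_mem_Hyp {n : ℕ} (y : Fin (n + 1) → ℝ) :
    (Fin.snoc y √(1 + ∑ i, y i ^ 2) : Fin (n + 2) → ℝ) ∈ Hyp n := by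
  have h : 0 ≤ ∑ i, y i ^ 2 := Finset.sum_nonneg fun i _ => sq_nonneg _
  refine ⟨?_, ?_⟩
  · rw [lprod_self]
    simp only [Fin.snoc_castSucc, Fin.snoc_last]
    rw [Real.sq_sqrt (by linarith)]
    ring
  · simp only [Fin.snoc_last]
    exact Real.sqrt_pos.2 (by linarith)

lemma neg_lprod_snoc_dir {n : ℕ} (e y : Fin (n + 1) → ℝ) :
    -lprod n (Fin.snoc y √(1 + ∑ i, y i ^ 2)) (dir e) = busemannExp e y := by
  rw [lprod_dir]
  simp [busemannExp]

lemma snoc_castSucc_of_mem_Hyp {n : ℕ} {X : Fin (n + 2) → ℝ} (hX : X ∈ Hyp n) :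
    (Fin.snoc (fun i => X (Fin.castSucc i)) √(1 + ∑ i : Fin (n + 1), X i.castSucc ^ 2) :
      Fin (n + 2) → ℝ) = X := by
  obtain ⟨hX, hX0⟩ := hX
  rw [lprod_self] at hX
  have : 1 + ∑ i : Fin (n + 1), X i.castSucc ^ 2 = X (Fin.last (n + 1)) ^ 2 := by linarith
  rw [this, Real.sqrt_sq hX0.le]
  exact Fin.snoc_init_self X

lemma continuous_busemannExp {n : ℕ} (e : Fin (n + 1) → ℝ) : Continuous (busemannExp e) := by
  unfold busemannExp
  fun_prop

lemma convexOn_busemannExp {n : ℕ} (e : Fin (n + 1) → ℝ) :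
    ConvexOn ℝ univ (busemannExp e) := by
  refine ⟨convex_univ, fun y _ z _ a b ha hb hab => ?_⟩
  have hyz := lprod_le_neg_one (snoc_mem_Hyp y) (snoc_mem_Hyp z)
  simp only [lprod, Fin.snoc_castSucc, Fin.snoc_last] at hyz
  have hy := Real.sq_sqrt (show 0 ≤ 1 + ∑ i, y i ^ 2 by positivity)
  have hz := Real.sq_sqrt (show 0 ≤ 1 + ∑ i, z i ^ 2 by positivity)
  have hlin : ∑ i, (a • y + b • z) i * e i = a * ∑ i, y i * e i + b * ∑ i, z i * e i := by
    rw [Finset.mul_sum, Finset.mul_sum, ← Finset.sum_add_distrib]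
    exact Finset.sum_congr rfl fun i _ => by simp; ring
  have hquad : ∑ i, (a • y + b • z) i ^ 2 =
      a ^ 2 * ∑ i, y i ^ 2 + b ^ 2 * ∑ i, z i ^ 2 + 2 * (a * b) * ∑ i, y i * z i := by
    rw [Finset.mul_sum, Finset.mul_sum, Finset.mul_sum, ← Finset.sum_add_distrib,
      ← Finset.sum_add_distrib]
    exact Finset.sum_congr rfl fun i _ => by simp; ring
  simp only [busemannExp, smul_eq_mul]
  rw [hlin, hquad]
  set wy := √(1 + ∑ i, y i ^ 2)
  set wz := √(1 + ∑ i, z i ^ 2)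
  have hsqrt : √(1 + (a ^ 2 * ∑ i, y i ^ 2 + b ^ 2 * ∑ i, z i ^ 2 +
      2 * (a * b) * ∑ i, y i * z i)) ≤ a * wy + b * wz := by
    apply Real.sqrt_le_iff.2
    refine ⟨by positivity, ?_⟩
    have h1 : (a + b) ^ 2 = 1 := by rw [hab, one_pow]
    have h2 := mul_le_mul_of_nonneg_left hyz (mul_nonneg ha hb)
    nlinarith
  linarith

/-- The difference of two Busemann exponentials, as a linear functional. -/
def busemannDiff {n : ℕ} (e₁ e₂ : Fin (n + 1) → ℝ) : (Fin (n + 1) → ℝ) →ₗ[ℝ] ℝ :=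
  ∑ i, (e₂ i - e₁ i) • LinearMap.proj i

lemma busemannDiff_apply {n : ℕ} (e₁ e₂ y : Fin (n + 1) → ℝ) :
    busemannDiff e₁ e₂ y = busemannExp e₁ y - busemannExp e₂ y := by
  simp only [busemannDiff, LinearMap.sum_apply, LinearMap.smul_apply, LinearMap.proj_apply,
    smul_eq_mul, busemannExp, sub_mul, Finset.sum_sub_distrib, mul_comm (y _)]
  ring

lemma busemannDiff_ne_zero {n : ℕ} {e₁ e₂ : Fin (n + 1) → ℝ} (hne : e₁ ≠ e₂) :
    busemannDiff e₁ e₂ ≠ 0 := by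
  classical
  obtain ⟨i, hi⟩ := Function.ne_iff.1 hne
  intro h
  have := LinearMap.congr_fun h (Pi.single i 1)
  simp [busemannDiff, Pi.single_apply] at this
  exact hi (sub_eq_zero.1 this).symm

/-- Inside an intersection of two horo-balls with different centres all coordinates are
bounded. -/
lemma exists_coord_bound {n : ℕ} {e₁ e₂ : Fin (n + 1) → ℝ} (he₁ : e₁ ∈ sph n)
    (he₂ : e₂ ∈ sph n) (hne : e₁ ≠ e₂) (S : ℝ) : ∃ R : ℝ, 0 ≤ R ∧ ∀ y : Fin (n + 1) → ℝ,
      busemannExp e₁ y + busemannExp e₂ y ≤ S → ∀ i, |y i| ≤ R := by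
  have hk := lprod_dir_dir_neg he₁ he₂ hne
  have hk2 := neg_two_le_lprod_dir_dir he₁ he₂
  rw [lprod_dir_dir] at hk hk2
  have h1 : ∑ i, e₁ i ^ 2 = 1 := he₁
  have h2 : ∑ i, e₂ i ^ 2 = 1 := he₂
  have h4 : ∑ i, (e₁ i + e₂ i) ^ 2 = 2 + 2 * ∑ i, e₁ i * e₂ i := by
    calc _ = ∑ i, e₁ i ^ 2 + ∑ i, e₂ i ^ 2 + 2 * ∑ i, e₁ i * e₂ i := by
          rw [Finset.mul_sum, ← Finset.sum_add_distrib, ← Finset.sum_add_distrib]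
          exact Finset.sum_congr rfl fun i _ => by ring
      _ = _ := by rw [h1, h2]; ring
  set m := 2 + 2 * ∑ i, e₁ i * e₂ i with hm
  have hm0 : 0 ≤ m := by linarith
  have hm4 : √m < 2 := (Real.sqrt_lt' two_pos).2 (by linarith)
  refine ⟨|S| / (2 - √m), div_nonneg (abs_nonneg _) (by linarith), fun y hy i => ?_⟩
  have hcs := Finset.sum_mul_sq_le_sq_mul_sq Finset.univ (fun i => e₁ i + e₂ i) y
  rw [h4] at hcs
  set w := √(1 + ∑ i, y i ^ 2) with hw
  have hw2 : w ^ 2 = 1 + ∑ i, y i ^ 2 := Real.sq_sqrt (by positivity)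
  have hw0 : 0 ≤ w := Real.sqrt_nonneg _
  have hsum : ∑ i, (e₁ i + e₂ i) * y i = ∑ i, y i * e₁ i + ∑ i, y i * e₂ i := by
    rw [← Finset.sum_add_distrib]
    exact Finset.sum_congr rfl fun i _ => by ring
  have hs : ∑ i, (e₁ i + e₂ i) * y i ≤ √m * w := by
    refine (abs_le_of_sq_le_sq' (hcs.trans ?_) (by positivity)).2
    rw [mul_pow, Real.sq_sqrt hm0, hw2]
    nlinarith
  simp only [busemannExp, ← hw] at hy
  have hwS : w ≤ |S| / (2 - √m) := by
    rw [le_div_iff₀ (by linarith)]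
    have := le_abs_self S
    nlinarith
  refine le_trans (abs_le_of_sq_le_sq ?_ hw0) hwS
  have := Finset.single_le_sum (f := fun i => y i ^ 2) (fun i _ => sq_nonneg _)
    (Finset.mem_univ i)
  linarith

/-- If the horo-balls overlap in their interiors, then some point lies inside the first one by the
same amount (measured exponentially) as inside the second one. -/
lemma exists_busemannExp_lt {n : ℕ} {e₁ e₂ : Fin (n + 1) → ℝ} (he₁ : e₁ ∈ sph n)
    (he₂ : e₂ ∈ sph n) (hne : e₁ ≠ e₂) {A₁ A₂ : ℝ} (hA₁ : 1 < A₁) (hA₂ : 1 < A₂) :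
    ∃ y : Fin (n + 1) → ℝ, busemannDiff e₁ e₂ y = A₁ - A₂ ∧ busemannExp e₁ y < A₁ := by
  have hk := lprod_dir_dir_neg he₁ he₂ hne
  have hk2 := neg_two_le_lprod_dir_dir he₁ he₂
  set k := lprod n (dir e₁) (dir e₂) with hkdef
  have hk0 : k ≠ 0 := hk.ne
  set q := A₁ - A₂ with hq
  have hr2 := Real.sq_sqrt (show 0 ≤ q ^ 2 - 2 * k by nlinarith)
  have hr : |q| < √(q ^ 2 - 2 * k) := Real.lt_sqrt_of_sq_lt (by rw [sq_abs]; linarith)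
  set r := √(q ^ 2 - 2 * k)
  have hq1 := neg_abs_le q
  set a := (q + r) / 2 with ha
  have ha0 : 0 < a := by linarith
  have haq : a * (a - q) = -k / 2 := by rw [ha]; linear_combination hr2 / 4
  set X : Fin (n + 2) → ℝ := ((q - a) / k) • dir e₁ + (-a / k) • dir e₂ with hX
  have h1 : lprod n X (dir e₁) = -a := by
    rw [hX, lprod_add_left, lprod_smul_left, lprod_smul_left, lprod_dir_self he₁,
      lprod_comm n (dir e₂), ← hkdef]
    field_simp
    ring
  have h2 : lprod n X (dir e₂) = q - a := by
    rw [hX, lprod_add_left, lprod_smul_left, lprod_smul_left, lprod_dir_self he₂, ← hkdef]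
    field_simp
    ring
  have h3 : lprod n X X = -1 := by
    conv_lhs => rw [hX, lprod_add_right, lprod_smul_right, lprod_smul_right, ← hX, h1, h2]
    field_simp
    linarith
  have hXH : X ∈ Hyp n := mem_Hyp_of_lprod_dir_neg he₁ h3 (by rw [h1]; linarith)
  have hbus : ∀ e, busemannExp e (fun i => X (Fin.castSucc i)) = -lprod n X (dir e) := by
    intro e
    rw [← neg_lprod_snoc_dir, snoc_castSucc_of_mem_Hyp hXH]
  refine ⟨fun i => X (Fin.castSucc i), ?_, ?_⟩
  · rw [busemannDiff_apply, hbus, hbus, h1, h2]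
    ring
  · rw [hbus, h1, neg_neg]
    by_contra! h
    have h5 : A₂ ≤ a - q := by linarith
    nlinarith

/-- The hyperbolic volume of a set is at most the Lebesgue measure of any set containing its
projection. -/
lemma hypVol_le {n : ℕ} {E : Set (Fin (n + 2) → ℝ)} {S : Set (Fin (n + 1) → ℝ)} {c : ℝ}
    (hc : 0 ≤ c) (hS : MeasurableSet S) (hvol : volume S ≤ ENNReal.ofReal c)
    (hsub : ∀ y : Fin (n + 1) → ℝ, Fin.snoc y √(1 + ∑ i, y i ^ 2) ∈ E → y ∈ S) :
    hypVol n E ≤ c := by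
  have hfin : volume S ≠ ⊤ := ne_top_of_le_ne_top ENNReal.ofReal_ne_top hvol
  calc hypVol n E ≤ ∫ x, S.indicator (fun _ => (1 : ℝ)) x := by
        refine integral_mono_of_nonneg (Eventually.of_forall fun y => ?_)
          ((integrable_indicator_iff hS).2 (integrableOn_const hfin))
          (Eventually.of_forall fun y => ?_)
        · exact indicator_nonneg (fun y _ => by positivity) y
        · refine indicator_le' (fun z hz => ?_)
            (fun z _ => indicator_nonneg (fun _ _ => zero_le_one) z) y
          rw [indicator_of_mem (hsub z hz)]
          refine div_le_one_of_le₀ (Real.one_le_sqrt.2 ?_) (Real.sqrt_nonneg _)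
          exact le_add_of_nonneg_right (Finset.sum_nonneg fun i _ => sq_nonneg _)
    _ = volume.real S := by rw [integral_indicator hS]; simp
    _ ≤ c := ENNReal.toReal_le_of_le_ofReal hc hvol

/-- For `P = B̄_{e₁}(x₁) ∩ B̄_{e₂}(x₂)`, the collar `𝒫_t(P,F̊(P,e₁))` and the slab
`M(t) = (B̄_{e₁}(x₁+t) \ B̄_{e₁}(x₁)) ∩ B̄_{e₂}(x₂)` differ by volume at most `C t²` for
small `t > 0`. -/
theorem vol_symmDiff_collar_le (n : ℕ) (hn : 1 ≤ n)
    (e₁ e₂ : Fin (n + 1) → ℝ) (he₁ : e₁ ∈ sph n) (he₂ : e₂ ∈ sph n) (hne : e₁ ≠ e₂)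
    (x₁ x₂ : ℝ) (hx₁ : 0 < x₁) (hx₂ : 0 < x₂) :
    ∃ C > 0, ∃ t₀ > 0, ∀ t : ℝ, 0 < t → t < t₀ →
      hypVol n (((horoBallCl n e₁ (x₁ + t) \ horoBallCl n e₁ x₁) ∩ horoBallCl n e₂ x₂) ∆
          collar n (horoBallCl n e₁ x₁ ∩ horoBallCl n e₂ x₂) e₁ t)
        ≤ C * t ^ 2 := by
  set A₁ := exp x₁ with hA₁
  set A₂ := exp x₂ with hA₂
  have hA₁0 : 0 < A₁ := Real.exp_pos _
  have hA₂0 : 0 < A₂ := Real.exp_pos _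
  set p := busemannDiff e₁ e₂ with hp
  obtain ⟨y₀, hy₀, hy₀A⟩ := exists_busemannExp_lt he₁ he₂ hne (Real.one_lt_exp_iff.2 hx₁)
    (Real.one_lt_exp_iff.2 hx₂)
  obtain ⟨y₁, hy₁⟩ : ∃ y₁, p y₁ = 1 :=
    LinearMap.surjective (busemannDiff_ne_zero hne) 1
  obtain ⟨R, hR, hbound⟩ := exists_coord_bound he₁ he₂ hne (A₁ + (A₂ + 1))
  obtain ⟨K, hK, hslab⟩ := exists_volume_slab_le p (busemannDiff_ne_zero hne) hR
  set η := (A₁ - busemannExp e₁ y₀) / 2 with hη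
  have hη0 : 0 < η := half_pos (sub_pos.2 hy₀A)
  obtain ⟨ρ₀, hρ₀, hline⟩ : ∃ ρ₀ > 0, ∀ s : ℝ, |s| < ρ₀ →
      busemannExp e₁ (y₀ + s • y₁) ≤ A₁ - η := by
    have hcont : Continuous fun s : ℝ => busemannExp e₁ (y₀ + s • y₁) :=
      (continuous_busemannExp e₁).comp (by fun_prop)
    have hev : ∀ᶠ s in 𝓝 (0 : ℝ), busemannExp e₁ (y₀ + s • y₁) < A₁ - η :=
      hcont.continuousAt.eventually_lt_const (by simp; linarith)
    obtain ⟨ρ₀, hρ₀, h⟩ := Metric.eventually_nhds_iff.1 hev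
    exact ⟨ρ₀, hρ₀, fun s hs => (h (by simpa using hs)).le⟩
  set B := 2 * (A₁ + A₂) with hB
  have hB0 : 0 < B := by positivity
  refine ⟨2 ^ n * (B / η) * (K * B), by positivity, min 1 (min 1 (min η ρ₀) / B), by positivity,
    fun t ht htlt => ?_⟩
  have ht1 : t < 1 := htlt.trans_le (min_le_left _ _)
  have htB : t * B < min 1 (min η ρ₀) :=
    (lt_div_iff₀ hB0).1 (htlt.trans_le (min_le_right _ _))
  have hBt1 : t * B < 1 := htB.trans_le (min_le_left _ _)
  have hBtη : t * B < η := htB.trans_le ((min_le_right _ _).trans (min_le_left _ _))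
  have hBtρ : t * B < ρ₀ := htB.trans_le ((min_le_right _ _).trans (min_le_right _ _))
  have hBt0 : 0 < t * B := by positivity
  have hpc : Continuous p := p.continuous_of_finiteDimensional
  have hgc := continuous_busemannExp e₁
  have hRvol : volume {y | |p y - p y₀| ≤ t * B ∧ busemannExp e₁ y ≤ A₁} ≤
      ENNReal.ofReal (K * (t * B)) := by
    refine (measure_mono ?_).trans (hslab (p y₀) (t * B) hBt0.le)
    rintro y ⟨h1, h2⟩
    refine ⟨hbound y ?_, h1⟩
    have h3 := (abs_le.1 h1).1
    rw [hy₀, busemannDiff_apply] at h3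
    linarith
  have hshell := volume_shell_le (convexOn_busemannExp e₁) hgc p hy₁ hη0 hBt0.le hBtη.le
    (fun s hs => hline s (hs.trans_lt hBtρ)) hRvol
  have hfinal : 2 ^ n * (B / η) * (K * B) * t ^ 2 = 2 ^ n * (t * B / η) * (K * (t * B)) := by
    ring
  rw [hfinal]
  refine hypVol_le (by positivity) ?_ hshell fun y hy => ?_
  · exact (isClosed_le (hpc.sub continuous_const).abs continuous_const).measurableSet.inter
      ((isOpen_lt continuous_const hgc).measurableSet.inter
        (isClosed_le hgc continuous_const).measurableSet)
  · have hy' := symmDiff_collar_subset hn he₁ he₂ hne hx₁ hx₂ ht hy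
    simp only [neg_lprod_snoc_dir] at hy'
    obtain ⟨h1, h2, h3, h4⟩ := hy'
    have hexp : ∀ s, |s| = t → |exp s - 1| ≤ 2 * t := fun s hs =>
      hs ▸ Real.abs_exp_sub_one_le (by rw [hs]; exact ht1.le)
    have hpos := (abs_le.1 (hexp t (abs_of_pos ht))).2
    have hneg := (abs_le.1 (hexp (-t) (by rw [abs_neg, abs_of_pos ht]))).1
    rw [Real.exp_add, ← hA₁] at h2
    rw [Real.exp_add, ← hA₂] at h4
    rw [sub_eq_add_neg, Real.exp_add, ← hA₂] at h3
    have h2' : busemannExp e₁ y ≤ A₁ + 2 * A₁ * t := by nlinarith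
    have h4' : busemannExp e₂ y ≤ A₂ + 2 * A₂ * t := by nlinarith
    have h3' : A₂ - 2 * A₂ * t ≤ busemannExp e₂ y := by nlinarith
    have hA₁t : 0 < A₁ * t := by positivity
    have hA₂t : 0 < A₂ * t := by positivity
    have hBt : t * B = 2 * A₁ * t + 2 * A₂ * t := by rw [hB]; ring
    refine ⟨?_, h1, by linarith⟩
    rw [hy₀, busemannDiff_apply, abs_le]
    constructor <;> linarith

end Horo
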